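/- Suppose the simple Markov chain X satisfies, for some n ≥ 1: there exists a constant δ > 0 such that P^n(i,i) ≥ δ for all but finitely many states i ∈ S. Then the asymptotic period d(X) is a divisor of n. -/

import Mathlib

open MeasureTheory Filter Set ProbabilityTheory

/-- A discrete-time Markov chain on a state space `S`: a stochastic transition
matrix `P`, an initial distribution `init`, and the induced probability measure
`μ` on the path space `ℕ → S`, determined by its values on cylinder sets. -/
structure MarkovChain (S : Type) [MeasurableSpace S] where
  P : S → S → ℝ
  P_nonneg : ∀ i j, 0 ≤ P i j
  P_stochastic : ∀ i, HasSum (P i) 1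
  init : S → ℝ
  init_nonneg : ∀ i, 0 ≤ init i
  init_hasSum : HasSum init 1
  μ : Measure (ℕ → S)
  μ_prob : IsProbabilityMeasure μ
  μ_cylinder : ∀ (n : ℕ) (s : ℕ → S),
    μ {ω | ∀ k ≤ n, ω k = s k}
      = ENNReal.ofReal (init (s 0) * ∏ k ∈ Finset.range n, P (s k) (s (k + 1)))

namespace MarkovChain

variable {S : Type} [MeasurableSpace S]

open Classical in
/-- The `n`-step transition probabilities `P^n(i,j)`. -/
noncomputable def Pn (X : MarkovChain S) : ℕ → S → S → ℝ
  | 0, i, j => if i = j then 1 else 0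
  | n + 1, i, j => ∑' k : S, X.Pn n i k * X.P k j

/-- Irreducibility: every state can be reached from every state. -/
def Irreducible (X : MarkovChain S) : Prop := ∀ i j : S, ∃ n : ℕ, 0 < X.Pn n i j

/-- Aperiodicity: for each state, the gcd of the set `{n ≥ 1 | P^n(i,i) > 0}`
is `1` (expressed via common divisors). -/
def Aperiodic (X : MarkovChain S) : Prop :=
  ∀ i : S, ∀ d : ℕ, (∀ n : ℕ, 0 < n → 0 < X.Pn n i i → d ∣ n) → d = 1

/-- `U^(m)(C)`: the event that the `m`-step chain visits `C` infinitely often. -/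
def U (X : MarkovChain S) (m : ℕ) (C : Set S) : Set (ℕ → S) :=
  {ω | ∀ n : ℕ, ∃ k : ℕ, n ≤ k ∧ ω (k * m) ∈ C}

/-- `L^(m)(C)`: the event that the `m`-step chain is eventually in `C`. -/
def L (X : MarkovChain S) (m : ℕ) (C : Set S) : Set (ℕ → S) :=
  {ω | ∃ n : ℕ, ∀ k : ℕ, n ≤ k → ω (k * m) ∈ C}

/-- `C` is transient with respect to the `m`-step chain `X^(m)`. -/
def Transient (X : MarkovChain S) (m : ℕ) (C : Set S) : Prop := X.μ (X.U m C) = 0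

/-- `C` is regular with respect to `X^(m)`: `U^(m)(C)` and `L^(m)(C)` agree up
to a null event. -/
def Regular (X : MarkovChain S) (m : ℕ) (C : Set S) : Prop :=
  X.μ (symmDiff (X.U m C) (X.L m C)) = 0

/-- `C` is almost closed with respect to `X^(m)`: regular but not transient. -/
def AlmostClosed (X : MarkovChain S) (m : ℕ) (C : Set S) : Prop :=
  X.Regular m C ∧ ¬ X.Transient m C

/-- An almost closed set is atomic if it does not contain two disjoint almost
closed subsets. -/
def Atomic (X : MarkovChain S) (m : ℕ) (C : Set S) : Prop :=
  X.AlmostClosed m C ∧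
    ¬ ∃ A B : Set S, A ⊆ C ∧ B ⊆ C ∧ Disjoint A B ∧
      X.AlmostClosed m A ∧ X.AlmostClosed m B

/-- A Blackwell decomposition for the `m`-step chain `X^(m)`: a countable
collection of pairwise disjoint almost closed sets, all atomic except at most
one, where a nonatomic member contains no atomic subsets and consists of
transient states, and such that the probabilities `μ(L^(m)(C))` sum to one. -/
structure IsBlackwell (X : MarkovChain S) (m : ℕ) (𝒞 : Set (Set S)) : Prop where
  countable : 𝒞.Countable
  almostClosed : ∀ C ∈ 𝒞, X.AlmostClosed m C
  disjoint : 𝒞.PairwiseDisjoint id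
  atMostOneNonatomic : ∀ C₁ ∈ 𝒞, ∀ C₂ ∈ 𝒞, ¬ X.Atomic m C₁ → ¬ X.Atomic m C₂ → C₁ = C₂
  nonatomicNoAtomicSubset : ∀ C ∈ 𝒞, ¬ X.Atomic m C → ∀ A : Set S, A ⊆ C → ¬ X.Atomic m A
  nonatomicTransientStates : ∀ C ∈ 𝒞, ¬ X.Atomic m C → ∀ i ∈ C, X.Transient m {i}
  sum_L_eq_one : ∑' C : 𝒞, X.μ (X.L m (C : Set S)) = 1

/-- `β(X^(m))`: the number of sets in a Blackwell decomposition for `X^(m)`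
(well defined since the decomposition is unique up to equivalence). -/
noncomputable def beta (X : MarkovChain S) (m : ℕ) : ℕ∞ :=
  sInf (Set.encard '' {𝒞 : Set (Set S) | X.IsBlackwell m 𝒞})

/-- `X` is simple if `β(X) = 1`. -/
def Simple (X : MarkovChain S) : Prop := X.beta 1 = 1

/-- The asymptotic period `d(X) = sup {m ≥ 1 | β(X^(m)) = m}` (possibly `∞`). -/
noncomputable def period (X : MarkovChain S) : ℕ∞ :=
  sSup {d : ℕ∞ | ∃ m : ℕ, 1 ≤ m ∧ X.beta m = (m : ℕ∞) ∧ d = (m : ℕ∞)}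

/-- Recurrence: every state is visited infinitely often almost surely. -/
def Recurrent (X : MarkovChain S) : Prop := ∀ i : S, X.μ (X.U 1 {i}) = 1

end MarkovChain

/-- The shift operator `θ` on path space: `(θ ω)(n) = ω(n+1)`. -/
def pathShift {S : Type} : (ℕ → S) → ℕ → S := fun ω n => ω (n + 1)

/-- An event `E` is `m`-invariant if its indicator function `f` satisfies
`f(ω) = f(θ^m ω)` for all paths `ω`. -/
def MInvariant {S : Type} (m : ℕ) (E : Set (ℕ → S)) : Prop :=
  ∀ ω : ℕ → S, ω ∈ E ↔ pathShift^[m] ω ∈ E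

/-- A birth-death process: a Markov chain on `ℕ` with positive birth
probabilities `p_i = P(i,i+1)`, positive death probabilities `q_{i+1} = P(i+1,i)`,
all transition probabilities other than `p_i`, `q_i` and `r_i = P(i,i)` zero,
and at least one positive self-transition probability. -/
structure MarkovChain.IsBirthDeath (X : MarkovChain ℕ) : Prop where
  birth_pos : ∀ i : ℕ, 0 < X.P i (i + 1)
  death_pos : ∀ i : ℕ, 0 < X.P (i + 1) i
  tridiagonal : ∀ i j : ℕ, 1 < |(i : ℤ) - (j : ℤ)| → X.P i j = 0
  self_pos : ∃ i : ℕ, 0 < X.P i i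

/-- The path shifted by `k` steps. -/
def pathDrop {S : Type} (k : ℕ) (ω : ℕ → S) : ℕ → S := fun j => ω (j + k)

/-- The paths that agree with `s` up to time `k`. -/
def pathCylinder {S : Type} (k : ℕ) (s : ℕ → S) : Set (ℕ → S) := {ω | ∀ j ≤ k, ω j = s j}

/-- The event `A` depends only on the path up to time `k`. -/
def DeterminedBy {S : Type} (k : ℕ) (A : Set (ℕ → S)) : Prop :=
  ∀ ω ω' : ℕ → S, (∀ j ≤ k, ω j = ω' j) → ω ∈ A → ω' ∈ A

section PathSpace

variable {S : Type}

theorem pathDrop_pathDrop (a b : ℕ) (ω : ℕ → S) :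
    pathDrop a (pathDrop b ω) = pathDrop (a + b) ω := by
  funext j; simp [pathDrop, add_assoc]

theorem DeterminedBy.mono {k l : ℕ} {A : Set (ℕ → S)} (h : DeterminedBy k A) (hkl : k ≤ l) :
    DeterminedBy l A := fun ω ω' hω => h ω ω' fun j hj => hω j (hj.trans hkl)

theorem DeterminedBy.compl {k : ℕ} {A : Set (ℕ → S)} (h : DeterminedBy k A) :
    DeterminedBy k Aᶜ := fun ω ω' hω hA hA' => hA (h ω' ω (fun j hj => (hω j hj).symm) hA')

theorem DeterminedBy.union {k : ℕ} {A B : Set (ℕ → S)} (hA : DeterminedBy k A)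
    (hB : DeterminedBy k B) : DeterminedBy k (A ∪ B) :=
  fun ω ω' hω => Or.imp (hA ω ω' hω) (hB ω ω' hω)

/-- Invariance under the `m`-step shift propagates to shifts by multiples of `m`. -/
theorem pathDrop_mul_mem_iff {m : ℕ} {E : Set (ℕ → S)} (hE : ∀ ω, pathDrop m ω ∈ E ↔ ω ∈ E)
    (k : ℕ) (ω : ℕ → S) : pathDrop (k * m) ω ∈ E ↔ ω ∈ E := by
  induction k with
  | zero => simp [show pathDrop 0 ω = ω from rfl]
  | succ k ih => rw [← ih, ← hE (pathDrop (k * m) ω), pathDrop_pathDrop]; ring_nf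

/-- The initial segment of a path up to time `k`. -/
def initialSegment (k : ℕ) (ω : ℕ → S) : Fin (k + 1) → S := fun j => ω j

theorem initialSegment_preimage (k : ℕ) (s : ℕ → S) :
    initialSegment k ⁻¹' {initialSegment k s} = pathCylinder k s := by
  ext ω
  simp only [mem_preimage, mem_singleton_iff, funext_iff, initialSegment, pathCylinder,
    mem_ofPred_eq]
  exact ⟨fun h j hj => h ⟨j, by omega⟩, fun h j => h j (by omega)⟩

theorem DeterminedBy.eq_preimage {k : ℕ} {A : Set (ℕ → S)} (hA : DeterminedBy k A) :
    A = initialSegment k ⁻¹' (initialSegment k '' A) := by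
  refine (subset_preimage_image _ _).antisymm ?_
  rintro ω ⟨ω', h, h'⟩
  refine hA ω' ω (fun j hj => ?_) h
  exact congrFun h' ⟨j, by omega⟩

theorem isSetAlgebra_determinedBy : IsSetAlgebra {A : Set (ℕ → S) | ∃ k, DeterminedBy k A} where
  empty_mem := ⟨0, fun _ _ _ h => h⟩
  compl_mem := fun _ ⟨k, h⟩ => ⟨k, h.compl⟩
  union_mem := fun _ _ ⟨k, h⟩ ⟨l, h'⟩ =>
    ⟨max k l, (h.mono (le_max_left k l)).union (h'.mono (le_max_right k l))⟩

variable [MeasurableSpace S]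

theorem measurable_pathDrop (k : ℕ) : Measurable (pathDrop (S := S) k) :=
  measurable_pi_lambda _ fun j => measurable_pi_apply (j + k)

theorem measurable_initialSegment (k : ℕ) : Measurable (initialSegment (S := S) k) :=
  measurable_pi_lambda _ fun j => measurable_pi_apply (j : ℕ)

variable [MeasurableSingletonClass S] [Countable S]

theorem measurableSet_coord (k : ℕ) (C : Set S) : MeasurableSet {ω : ℕ → S | ω k ∈ C} :=
  measurable_pi_apply k C.to_countable.measurableSet

theorem measurableSet_pathCylinder (k : ℕ) (s : ℕ → S) : MeasurableSet (pathCylinder k s) := by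
  have : pathCylinder k s = ⋂ j : ℕ, ⋂ _ : j ≤ k, {ω : ℕ → S | ω j ∈ ({s j} : Set S)} := by
    ext ω; simp [pathCylinder]
  rw [this]
  exact .iInter fun j => .iInter fun _ => measurableSet_coord j _

theorem DeterminedBy.measurableSet {k : ℕ} {A : Set (ℕ → S)} (hA : DeterminedBy k A) :
    MeasurableSet A := by
  rw [hA.eq_preimage]
  exact measurable_initialSegment k (Set.to_countable _).measurableSet

/-- A measure inequality on the cylinders contained in `A` extends to `A`. -/
theorem DeterminedBy.measure_le {k : ℕ} {A : Set (ℕ → S)} (hA : DeterminedBy k A)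
    {ν₁ ν₂ : Measure (ℕ → S)} (h : ∀ s ∈ A, ν₁ (pathCylinder k s) ≤ ν₂ (pathCylinder k s)) :
    ν₁ A ≤ ν₂ A := by
  have key : ∀ ν : Measure (ℕ → S), ν A
      = ∑' b : ↥(initialSegment k '' A), ν (initialSegment k ⁻¹' {(b : Fin (k + 1) → S)}) := by
    intro ν
    rw [tsum_measure_preimage_singleton (Set.to_countable _)
      (fun y _ => measurable_initialSegment k (measurableSet_singleton y)), ← hA.eq_preimage]
  rw [key ν₁, key ν₂]
  refine ENNReal.tsum_le_tsum ?_
  rintro ⟨_, s, hs, rfl⟩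
  rw [initialSegment_preimage]
  exact h s hs

theorem generateFrom_determinedBy :
    (MeasurableSpace.pi : MeasurableSpace (ℕ → S))
      = MeasurableSpace.generateFrom {A | ∃ k, DeterminedBy k A} := by
  refine le_antisymm ?_ (MeasurableSpace.generateFrom_le fun A ⟨k, hA⟩ => hA.measurableSet)
  refine iSup_le fun j => ?_
  rintro _ ⟨B, -, rfl⟩
  refine MeasurableSpace.measurableSet_generateFrom ⟨j, fun ω ω' h hω => ?_⟩
  simpa [← h j le_rfl] using hω

theorem exists_determinedBy_approx (μ : Measure (ℕ → S)) [IsFiniteMeasure μ]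
    {D : Set (ℕ → S)} (hD : MeasurableSet D) {ε : ℝ} (hε : 0 < ε) :
    ∃ k A, DeterminedBy k A ∧ μ (symmDiff D A) < ENNReal.ofReal ε := by
  obtain ⟨A, ⟨k, hA⟩, h⟩ := (Measure.MeasureDense.of_generateFrom_isSetAlgebra_finite μ
    isSetAlgebra_determinedBy generateFrom_determinedBy).approx D hD (measure_ne_top _ _) ε hε
  exact ⟨k, A, hA, h⟩

/-- A finite measure on path space is determined by its values on cylinders. -/
theorem measure_ext_of_pathCylinder {ν₁ ν₂ : Measure (ℕ → S)} [IsFiniteMeasure ν₁]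
    (h : ∀ k s, ν₁ (pathCylinder k s) = ν₂ (pathCylinder k s)) : ν₁ = ν₂ := by
  have hdet : ∀ A ∈ {A : Set (ℕ → S) | ∃ k, DeterminedBy k A}, ν₁ A = ν₂ A := by
    rintro A ⟨k, hA⟩
    exact (hA.measure_le fun s _ => (h k s).le).antisymm (hA.measure_le fun s _ => (h k s).ge)
  refine ext_of_generate_finite _ generateFrom_determinedBy ?_ hdet ?_
  · rintro A ⟨k, hA⟩ B ⟨l, hB⟩ -
    refine ⟨max k l, fun ω ω' hω h => ⟨?_, ?_⟩⟩
    · exact hA.mono (le_max_left k l) ω ω' hω h.1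
    · exact hB.mono (le_max_right k l) ω ω' hω h.2
  · exact hdet univ ⟨0, fun _ _ _ _ => mem_univ _⟩

end PathSpace

namespace MarkovChain

section Transition

variable {S : Type} [MeasurableSpace S] (X : MarkovChain S)

instance : IsProbabilityMeasure X.μ := X.μ_prob

open Classical in
/-- The `n`-step transition probabilities, with values in `ℝ≥0∞`. -/
noncomputable def ennPn : ℕ → S → S → ENNReal
  | 0, i, j => if i = j then 1 else 0
  | n + 1, i, j => ∑' k : S, ennPn n i k * ENNReal.ofReal (X.P k j)

theorem tsum_ofReal_P (i : S) : ∑' j, ENNReal.ofReal (X.P i j) = 1 := by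
  rw [← ENNReal.ofReal_tsum_of_nonneg (X.P_nonneg i) (X.P_stochastic i).summable,
    (X.P_stochastic i).tsum_eq, ENNReal.ofReal_one]

theorem tsum_ennPn (n : ℕ) (i : S) : ∑' j, X.ennPn n i j = 1 := by
  induction n with
  | zero =>
    rw [tsum_eq_single i]
    · simp [ennPn]
    · intro j hj; simp [ennPn, hj.symm]
  | succ n ih =>
    simp only [ennPn]
    rw [ENNReal.tsum_comm]
    simp_rw [ENNReal.tsum_mul_left, tsum_ofReal_P, mul_one, ih]

theorem ennPn_le_one (n : ℕ) (i j : S) : X.ennPn n i j ≤ 1 :=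
  (ENNReal.le_tsum j).trans (X.tsum_ennPn n i).le

theorem ennPn_ne_top (n : ℕ) (i j : S) : X.ennPn n i j ≠ ⊤ :=
  ((X.ennPn_le_one n i j).trans_lt ENNReal.one_lt_top).ne

theorem toReal_ennPn (n : ℕ) (i j : S) : (X.ennPn n i j).toReal = X.Pn n i j := by
  induction n generalizing j with
  | zero => by_cases h : i = j <;> simp [ennPn, Pn, h]
  | succ n ih =>
    simp only [ennPn, Pn]
    rw [ENNReal.tsum_toReal_eq
      (fun k => ENNReal.mul_ne_top (X.ennPn_ne_top n i k) ENNReal.ofReal_ne_top)]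
    simp [ih, X.P_nonneg]

theorem ofReal_le_ennPn {δ : ℝ} {n : ℕ} {i j : S} (h : δ ≤ X.Pn n i j) :
    ENNReal.ofReal δ ≤ X.ennPn n i j := by
  rw [← X.toReal_ennPn] at h
  exact ENNReal.ofReal_le_of_le_toReal h

/-- The probability of following the path `t` for `l` steps, starting from `t 0`. -/
noncomputable def pathWeight (l : ℕ) (t : ℕ → S) : ENNReal :=
  ∏ r ∈ Finset.range l, ENNReal.ofReal (X.P (t r) (t (r + 1)))

theorem μ_pathCylinder (k : ℕ) (s : ℕ → S) :
    X.μ (pathCylinder k s) = ENNReal.ofReal (X.init (s 0)) * X.pathWeight k s := by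
  rw [pathCylinder, X.μ_cylinder, ENNReal.ofReal_mul (X.init_nonneg _), pathWeight,
    ENNReal.ofReal_prod_of_nonneg fun _ _ => X.P_nonneg _ _]

end Transition

section MarkovProperty

variable {S : Type} [MeasurableSpace S] [MeasurableSingletonClass S] [Countable S]
  (X : MarkovChain S)

open Classical in
/-- The Markov property on cylinders. -/
theorem μ_pathCylinder_inter (k : ℕ) (s : ℕ → S) (n l : ℕ) (t : ℕ → S) :
    X.μ (pathCylinder k s ∩ pathDrop (k + n) ⁻¹' pathCylinder l t)
      = X.μ (pathCylinder k s) * X.ennPn n (s k) (t 0) * X.pathWeight l t := by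
  induction n generalizing l t with
  | zero =>
    by_cases h : s k = t 0
    · have hset : pathCylinder k s ∩ pathDrop (k + 0) ⁻¹' pathCylinder l t
          = pathCylinder (k + l) (fun r => if r ≤ k then s r else t (r - k)) := by
        ext ω
        simp only [pathCylinder, pathDrop, mem_inter_iff, mem_preimage, mem_ofPred_eq, add_zero]
        constructor
        · rintro ⟨h1, h2⟩ j hj
          split_ifs with hjk
          · exact h1 j hjk
          · have := h2 (j - k) (by omega)
            rwa [Nat.sub_add_cancel (by omega)] at this
        · intro h1
          refine ⟨fun j hj => by simpa [hj] using h1 j (by omega), fun j hj => ?_⟩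
          have := h1 (j + k) (by omega)
          rcases Nat.eq_zero_or_pos j with rfl | hj0
          · simpa [h] using this
          · simpa [show ¬ j = 0 by omega] using this
      rw [hset, μ_pathCylinder, μ_pathCylinder]
      simp only [ennPn, h, if_true, mul_one, Nat.zero_le, pathWeight]
      rw [mul_assoc, Finset.prod_range_add]
      congr 2
      · refine Finset.prod_congr rfl fun r hr => ?_
        have := Finset.mem_range.1 hr
        rw [if_pos (by omega), if_pos (by omega)]
      · refine Finset.prod_congr rfl fun r _ => ?_
        rw [if_neg (show ¬ k + r + 1 ≤ k by omega), show k + r + 1 - k = r + 1 by omega]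
        split_ifs with hr
        · obtain rfl : r = 0 := by omega
          simp [h]
        · simp
    · have hset : pathCylinder k s ∩ pathDrop (k + 0) ⁻¹' pathCylinder l t = ∅ := by
        rw [eq_empty_iff_forall_notMem]
        rintro ω ⟨h1, h2⟩
        have h3 := h2 0 (Nat.zero_le _)
        simp only [pathDrop, zero_add, add_zero] at h3
        exact h ((h1 k le_rfl).symm.trans h3)
      rw [hset]
      simp [ennPn, h]
  | succ n ih =>
    let t' : S → ℕ → S := fun u r => if r = 0 then u else t (r - 1)
    have hfib : ∀ u, pathCylinder k s ∩ pathDrop (k + n) ⁻¹' pathCylinder (l + 1) (t' u)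
        = (fun ω : ℕ → S => ω (k + n)) ⁻¹' {u}
          ∩ (pathCylinder k s ∩ pathDrop (k + (n + 1)) ⁻¹' pathCylinder l t) := by
      intro u
      ext ω
      simp only [pathCylinder, pathDrop, mem_inter_iff, mem_preimage, mem_ofPred_eq,
        mem_singleton_iff, t']
      constructor
      · rintro ⟨h1, h2⟩
        refine ⟨by simpa using h2 0 (Nat.zero_le _), h1, fun j hj => ?_⟩
        have := h2 (j + 1) (by omega)
        simpa [show j + 1 + (k + n) = j + (k + (n + 1)) by ring] using this
      · rintro ⟨h0, h1, h2⟩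
        refine ⟨h1, fun j hj => ?_⟩
        rcases j with _ | j
        · simpa using h0
        · have := h2 j (by omega)
          simpa [show j + 1 + (k + n) = j + (k + (n + 1)) by ring] using this
    have hmeas : MeasurableSet
        (pathCylinder k s ∩ pathDrop (k + (n + 1)) ⁻¹' pathCylinder l t) :=
      (measurableSet_pathCylinder k s).inter
        (measurable_pathDrop _ (measurableSet_pathCylinder l t))
    have hsum := tsum_measure_preimage_singleton
      (μ := X.μ.restrict (pathCylinder k s ∩ pathDrop (k + (n + 1)) ⁻¹' pathCylinder l t))
      (s := (univ : Set S)) (f := fun ω : ℕ → S => ω (k + n)) (Set.to_countable _)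
      (fun y _ => measurableSet_coord (k + n) {y})
    rw [tsum_univ fun b : S => (X.μ.restrict (pathCylinder k s ∩
      pathDrop (k + (n + 1)) ⁻¹' pathCylinder l t)) ((fun ω : ℕ → S => ω (k + n)) ⁻¹' {b})] at hsum
    rw [preimage_univ, Measure.restrict_apply_univ] at hsum
    rw [← hsum]
    simp_rw [Measure.restrict_apply' hmeas, ← hfib, ih]
    simp only [ennPn]
    rw [← ENNReal.tsum_mul_left, ← ENNReal.tsum_mul_right]
    refine tsum_congr fun u => ?_
    simp only [pathWeight]
    rw [Finset.prod_range_succ']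
    simp only [t', if_true, Nat.add_eq_zero_iff, one_ne_zero, and_false, if_false,
      Nat.add_sub_cancel, zero_add]
    ring

/-- The Markov property at a fixed time, for events that return to the current state. -/
theorem μ_pathCylinder_return (k : ℕ) (s : ℕ → S) (n : ℕ) {B : Set (ℕ → S)}
    (hB : MeasurableSet B) :
    X.μ (pathCylinder k s ∩ {ω | ω (k + n) = s k} ∩ pathDrop (k + n) ⁻¹' B)
      = X.ennPn n (s k) (s k) * X.μ (pathCylinder k s ∩ pathDrop k ⁻¹' B) := by
  have hc : MeasurableSet (pathCylinder k s) := measurableSet_pathCylinder k s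
  have hr : MeasurableSet (pathCylinder k s ∩ {ω | ω (k + n) = s k}) :=
    hc.inter (measurableSet_coord (k + n) {s k})
  have hext : (X.μ.restrict (pathCylinder k s ∩ {ω | ω (k + n) = s k})).map (pathDrop (k + n))
      = X.ennPn n (s k) (s k) • (X.μ.restrict (pathCylinder k s)).map (pathDrop k) := by
    refine measure_ext_of_pathCylinder fun l t => ?_
    rw [Measure.map_apply (measurable_pathDrop _) (measurableSet_pathCylinder l t),
      Measure.smul_apply, Measure.map_apply (measurable_pathDrop _)
      (measurableSet_pathCylinder l t), Measure.restrict_apply' hr, Measure.restrict_apply' hc,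
      inter_comm, inter_comm _ (pathCylinder k s), smul_eq_mul]
    have h0 := X.μ_pathCylinder_inter k s 0 l t
    rw [add_zero] at h0
    rw [h0]
    by_cases h : s k = t 0
    · have hset : pathCylinder k s ∩ {ω | ω (k + n) = s k} ∩
          pathDrop (k + n) ⁻¹' pathCylinder l t
          = pathCylinder k s ∩ pathDrop (k + n) ⁻¹' pathCylinder l t := by
        ext ω
        refine ⟨fun h' => ⟨h'.1.1, h'.2⟩, fun h' => ⟨⟨h'.1, ?_⟩, h'.2⟩⟩
        have := h'.2 0 (Nat.zero_le _)
        simpa [pathDrop, h] using this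
      rw [hset, μ_pathCylinder_inter]
      simp only [ennPn, h, if_true]
      ring
    · have hset : pathCylinder k s ∩ {ω | ω (k + n) = s k} ∩
          pathDrop (k + n) ⁻¹' pathCylinder l t = ∅ := by
        rw [eq_empty_iff_forall_notMem]
        rintro ω ⟨⟨-, h1⟩, h2⟩
        have h3 := h2 0 (Nat.zero_le _)
        simp only [pathDrop, zero_add] at h3
        exact h (Eq.trans (Eq.symm h1) h3)
      simp [hset, ennPn, h]
  have := congrArg (fun ν => ν B) hext
  simp only [Measure.smul_apply, smul_eq_mul] at this
  rwa [Measure.map_apply (measurable_pathDrop _) hB, Measure.map_apply (measurable_pathDrop _) hB,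
    Measure.restrict_apply' hr, Measure.restrict_apply' hc, inter_comm,
    inter_comm _ (pathCylinder k s)] at this

/-- The law of the future depends on the past only through the current state. -/
theorem μ_pathCylinder_homogeneous {k k' : ℕ} {s s' : ℕ → S} (h : s k = s' k')
    {B : Set (ℕ → S)} (hB : MeasurableSet B) :
    X.μ (pathCylinder k s ∩ pathDrop k ⁻¹' B) * X.μ (pathCylinder k' s')
      = X.μ (pathCylinder k' s' ∩ pathDrop k' ⁻¹' B) * X.μ (pathCylinder k s) := by
  have hext : X.μ (pathCylinder k' s') • (X.μ.restrict (pathCylinder k s)).map (pathDrop k)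
      = X.μ (pathCylinder k s) • (X.μ.restrict (pathCylinder k' s')).map (pathDrop k') := by
    have : IsFiniteMeasure
        (X.μ (pathCylinder k' s') • (X.μ.restrict (pathCylinder k s)).map (pathDrop k)) :=
      Measure.smul_finite _ (measure_ne_top _ _)
    refine measure_ext_of_pathCylinder fun l t => ?_
    have h0 := X.μ_pathCylinder_inter k s 0 l t
    have h0' := X.μ_pathCylinder_inter k' s' 0 l t
    rw [add_zero] at h0 h0'
    simp only [Measure.smul_apply, smul_eq_mul]
    rw [Measure.map_apply (measurable_pathDrop _) (measurableSet_pathCylinder l t),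
      Measure.map_apply (measurable_pathDrop _) (measurableSet_pathCylinder l t),
      Measure.restrict_apply' (measurableSet_pathCylinder k s),
      Measure.restrict_apply' (measurableSet_pathCylinder k' s'),
      inter_comm, h0, inter_comm, h0', h]
    ring
  have := congrArg (fun ν => ν B) hext
  simp only [Measure.smul_apply, smul_eq_mul] at this
  rw [Measure.map_apply (measurable_pathDrop _) hB, Measure.map_apply (measurable_pathDrop _) hB,
    Measure.restrict_apply' (measurableSet_pathCylinder k s),
    Measure.restrict_apply' (measurableSet_pathCylinder k' s'),
    inter_comm, inter_comm _ (pathCylinder k' s')] at this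
  rw [mul_comm, this, mul_comm]

end MarkovProperty

section Events

variable {S : Type} [MeasurableSpace S] (X : MarkovChain S)

theorem L_subset_U (m : ℕ) (C : Set S) : X.L m C ⊆ X.U m C :=
  fun _ ⟨n, hn⟩ n' => ⟨max n n', le_max_right _ _, hn _ (le_max_left _ _)⟩

theorem U_mono (m : ℕ) {C D : Set S} (h : C ⊆ D) : X.U m C ⊆ X.U m D :=
  fun _ hω n => (hω n).imp fun _ hk => ⟨hk.1, h hk.2⟩

theorem L_inter {m : ℕ} {C D : Set S} {ω : ℕ → S} (hC : ω ∈ X.L m C) (hD : ω ∈ X.L m D) :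
    ω ∈ X.L m (C ∩ D) := by
  obtain ⟨a, ha⟩ := hC
  obtain ⟨b, hb⟩ := hD
  exact ⟨max a b, fun k hk => ⟨ha k ((le_max_left _ _).trans hk), hb k ((le_max_right _ _).trans hk)⟩⟩

theorem not_mem_L_of_mem_U {m : ℕ} {C D : Set S} (hCD : Disjoint C D) {ω : ℕ → S}
    (hC : ω ∈ X.U m C) : ω ∉ X.L m D := by
  rintro ⟨n, hn⟩
  obtain ⟨k, hk, hkC⟩ := hC n
  exact Set.disjoint_left.1 hCD hkC (hn k hk)

theorem mem_L_compl_of_not_mem_U {m : ℕ} {C : Set S} {ω : ℕ → S} (h : ω ∉ X.U m C) :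
    ω ∈ X.L m Cᶜ := by
  simp only [U, mem_ofPred_eq, not_forall, not_exists, not_and] at h
  exact h

theorem regular_iff {m : ℕ} {C : Set S} :
    X.Regular m C ↔ ∀ᵐ ω ∂X.μ, ω ∈ X.U m C → ω ∈ X.L m C := by
  rw [Regular, symmDiff_def, sdiff_eq_bot_iff.2 (X.L_subset_U m C), sup_bot_eq, ae_iff]
  simp only [Classical.not_imp]
  rfl

theorem AlmostClosed.ae {m : ℕ} {C : Set S} (h : X.AlmostClosed m C) :
    ∀ᵐ ω ∂X.μ, ω ∈ X.U m C → ω ∈ X.L m C := (regular_iff X).1 h.1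

theorem AlmostClosed.μ_L_ne_zero {m : ℕ} {C : Set S} (h : X.AlmostClosed m C) :
    X.μ (X.L m C) ≠ 0 := by
  intro h0
  refine h.2 (measure_mono_null_ae ?_ h0)
  filter_upwards [AlmostClosed.ae X h] with ω hω using hω

theorem almostClosed_of_ae {m : ℕ} {C : Set S} (h : ∀ᵐ ω ∂X.μ, ω ∈ X.U m C → ω ∈ X.L m C)
    (h0 : X.μ (X.L m C) ≠ 0) : X.AlmostClosed m C :=
  ⟨(regular_iff X).2 h, fun hU => h0 (measure_mono_null (X.L_subset_U m C) hU)⟩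

end Events

section ZeroOne

variable {S : Type} [MeasurableSpace S] [MeasurableSingletonClass S] [Countable S]
  (X : MarkovChain S)

theorem measurableSet_U (m : ℕ) (C : Set S) : MeasurableSet (X.U m C) := by
  have : X.U m C = ⋂ n : ℕ, ⋃ k : ℕ, ⋃ _ : n ≤ k, {ω | ω (k * m) ∈ C} := by
    ext ω; simp [U]
  rw [this]
  exact .iInter fun _ => .iUnion fun _ => .iUnion fun _ => measurableSet_coord _ C

theorem measurableSet_L (m : ℕ) (C : Set S) : MeasurableSet (X.L m C) := by
  have : X.L m C = ⋃ n : ℕ, ⋂ k : ℕ, ⋂ _ : n ≤ k, {ω | ω (k * m) ∈ C} := by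
    ext ω; simp [L]
  rw [this]
  exact .iUnion fun _ => .iInter fun _ => .iInter fun _ => measurableSet_coord _ C

/-- If, whenever the `m`-step chain is in `T`, the conditional probability of `G` given the past
is at least `c` times that of `E`, then almost surely `G` occurs when `E` does and the `m`-step
chain visits `T` infinitely often. -/
theorem ae_mem_of_frequently {m N : ℕ} (hm : 1 ≤ m) {E G : Set (ℕ → S)} {T : Set S}
    (hE : MeasurableSet E) (hG : MeasurableSet G) {c : ENNReal} (hc0 : c ≠ 0) (hc : c ≠ ⊤)
    (h : ∀ k, N ≤ k → ∀ s : ℕ → S, s (k * m) ∈ T →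
      c * X.μ (pathCylinder (k * m) s ∩ E) ≤ X.μ (pathCylinder (k * m) s ∩ G)) :
    ∀ᵐ ω ∂X.μ, ω ∈ E → ω ∈ X.U m T → ω ∈ G := by
  set D : Set (ℕ → S) := (E ∩ X.U m T) \ G with hD
  have hDm : MeasurableSet D := (hE.inter (X.measurableSet_U m T)).diff hG
  suffices hD0 : X.μ D = 0 by
    have := measure_eq_zero_iff_ae_notMem.1 hD0
    filter_upwards [this] with ω hω h1 h2
    by_contra h3
    exact hω ⟨⟨h1, h2⟩, h3⟩
  have hdet : ∀ k₀ A, DeterminedBy k₀ A → c * X.μ (A ∩ D) ≤ X.μ (A \ D) := by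
    intro k₀ A hA
    let k := max k₀ N
    have hkm : k₀ ≤ k * m := (le_max_left k₀ N).trans (Nat.le_mul_of_pos_right k hm)
    let B : ℕ → Set (ℕ → S) := fun l =>
      A ∩ {ω | k ≤ l ∧ ω (l * m) ∈ T ∧ ∀ j, k ≤ j → j < l → ω (j * m) ∉ T}
    have hBdet : ∀ l, DeterminedBy (l * m) (B l) := by
      rintro l ω ω' hω ⟨hωA, hkl, hlT, hj⟩
      refine ⟨hA.mono (hkm.trans (Nat.mul_le_mul_right m hkl)) ω ω' hω hωA, hkl, ?_, ?_⟩
      · rw [← hω (l * m) le_rfl]; exact hlT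
      · intro j hkj hjl
        rw [← hω (j * m) (Nat.mul_le_mul_right m hjl.le)]
        exact hj j hkj hjl
    have hBdisj : Pairwise (Function.onFun Disjoint B) := by
      intro l l' hll
      refine Set.disjoint_left.2 ?_
      rintro ω ⟨-, h1, h2, h3⟩ ⟨-, h1', h2', h3'⟩
      rcases lt_or_gt_of_ne hll with hlt | hlt
      · exact h3' l h1 hlt h2
      · exact h3 l' h1' hlt h2'
    have hBle : ∀ l, c * X.μ (B l ∩ E) ≤ X.μ (B l ∩ G) := by
      intro l
      have := (hBdet l).measure_le (ν₁ := c • X.μ.restrict E) (ν₂ := X.μ.restrict G)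
        (fun s hs => by
          rw [Measure.smul_apply, Measure.restrict_apply' hE, Measure.restrict_apply' hG]
          exact h l ((le_max_right k₀ N).trans hs.2.1) s hs.2.2.1)
      rwa [Measure.smul_apply, Measure.restrict_apply' hE, Measure.restrict_apply' hG] at this
    have hcover : A ∩ D ⊆ ⋃ l, B l ∩ E := by
      classical
      rintro ω ⟨hωA, ⟨hωE, hωU⟩, -⟩
      have hex := hωU k
      refine mem_iUnion.2 ⟨Nat.find hex, ⟨hωA, (Nat.find_spec hex).1, (Nat.find_spec hex).2, ?_⟩, hωE⟩
      exact fun j hkj hj hT => Nat.find_min hex hj ⟨hkj, hT⟩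
    calc c * X.μ (A ∩ D) ≤ c * ∑' l, X.μ (B l ∩ E) := by
          gcongr; exact (measure_mono hcover).trans (measure_iUnion_le _)
      _ = ∑' l, c * X.μ (B l ∩ E) := ENNReal.tsum_mul_left.symm
      _ ≤ ∑' l, X.μ (B l ∩ G) := ENNReal.tsum_le_tsum hBle
      _ = X.μ (⋃ l, B l ∩ G) := by
          refine (measure_iUnion (fun l l' hll => ?_) fun l => (hBdet l).measurableSet.inter hG).symm
          exact (hBdisj hll).mono inter_subset_left inter_subset_left
      _ ≤ X.μ (A \ D) := by
          refine measure_mono (iUnion_subset fun l ω hω => ⟨hω.1.1, fun hωD => hωD.2 hω.2⟩)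
  have hbound : ∀ ε : ℝ, 0 < ε → c * X.μ D ≤ (1 + c) * ENNReal.ofReal ε := by
    intro ε hε
    obtain ⟨k, A, hA, hlt⟩ := exists_determinedBy_approx X.μ hDm hε
    have h1 : X.μ D ≤ X.μ (A ∩ D) + X.μ (symmDiff D A) := by
      refine (measure_mono fun ω hω => ?_).trans (measure_union_le _ _)
      by_cases hωA : ω ∈ A
      · exact Or.inl ⟨hωA, hω⟩
      · exact Or.inr (Or.inl ⟨hω, hωA⟩)
    have h2 : X.μ (A \ D) ≤ X.μ (symmDiff D A) := measure_mono fun ω hω => Or.inr hω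
    calc c * X.μ D ≤ c * (X.μ (A ∩ D) + X.μ (symmDiff D A)) := by gcongr
      _ = c * X.μ (A ∩ D) + c * X.μ (symmDiff D A) := mul_add _ _ _
      _ ≤ X.μ (symmDiff D A) + c * X.μ (symmDiff D A) := by
          gcongr; exact (hdet k A hA).trans h2
      _ = (1 + c) * X.μ (symmDiff D A) := by ring
      _ ≤ (1 + c) * ENNReal.ofReal ε := by gcongr
  have hzero : c * X.μ D ≤ 0 := by
    have ht : Tendsto (fun ε : ℝ => (1 + c) * ENNReal.ofReal ε) (nhdsWithin 0 (Ioi 0))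
        (nhds ((1 + c) * ENNReal.ofReal 0)) :=
      ENNReal.Tendsto.const_mul
        (ENNReal.tendsto_ofReal (tendsto_id.mono_left nhdsWithin_le_nhds))
        (Or.inr (ENNReal.add_ne_top.2 ⟨ENNReal.one_ne_top, hc⟩))
    rw [ENNReal.ofReal_zero, mul_zero] at ht
    exact ge_of_tendsto ht (eventually_nhdsWithin_of_forall hbound)
  simpa [hc0] using hzero

/-- An invariant event agrees almost surely with the events that the chain is in some set `C`
infinitely often, and eventually. -/
theorem exists_set_of_invariant {G : Set (ℕ → S)} (hG : MeasurableSet G)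
    (hinv : ∀ ω, pathDrop 1 ω ∈ G ↔ ω ∈ G) :
    ∃ C : Set S, ∀ᵐ ω ∂X.μ, (ω ∈ X.U 1 C → ω ∈ G) ∧ (ω ∈ G → ω ∈ X.L 1 C) := by
  have hpre : ∀ k, pathDrop k ⁻¹' G = G := by
    intro k
    ext ω
    have := pathDrop_mul_mem_iff hinv k ω
    rwa [mul_one] at this
  let C : Set S := {i | ∃ (k : ℕ) (s : ℕ → S), s k = i ∧ X.μ (pathCylinder k s) ≠ 0 ∧
    2⁻¹ * X.μ (pathCylinder k s) ≤ X.μ (pathCylinder k s ∩ G)}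
  have hC : ∀ k s, s k ∈ C → 2⁻¹ * X.μ (pathCylinder k s) ≤ X.μ (pathCylinder k s ∩ G) := by
    rintro k s ⟨k', s', hs, h0, hle⟩
    have hom := X.μ_pathCylinder_homogeneous hs hG
    rw [hpre, hpre] at hom
    refine (ENNReal.mul_le_mul_iff_left h0 (measure_ne_top _ _)).1 ?_
    calc 2⁻¹ * X.μ (pathCylinder k s) * X.μ (pathCylinder k' s')
        = (2⁻¹ * X.μ (pathCylinder k' s')) * X.μ (pathCylinder k s) := by ring
      _ ≤ X.μ (pathCylinder k' s' ∩ G) * X.μ (pathCylinder k s) := by gcongr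
      _ = _ := hom
  have hC' : ∀ k s, s k ∈ Cᶜ → 2⁻¹ * X.μ (pathCylinder k s) ≤ X.μ (pathCylinder k s ∩ Gᶜ) := by
    intro k s hs
    by_cases h0 : X.μ (pathCylinder k s) = 0
    · simp [h0]
    · have hlt : X.μ (pathCylinder k s ∩ G) < 2⁻¹ * X.μ (pathCylinder k s) := by
        by_contra hle
        exact hs ⟨k, s, rfl, h0, not_lt.1 hle⟩
      have hadd := measure_inter_add_sdiff (μ := X.μ) (pathCylinder k s) hG
      rw [sdiff_eq] at hadd
      by_contra hlt'
      rw [not_le] at hlt'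
      have := ENNReal.add_lt_add hlt hlt'
      rw [hadd, ← add_mul, ENNReal.inv_two_add_inv_two, one_mul] at this
      exact lt_irrefl _ this
  refine ⟨C, ?_⟩
  have h1 := X.ae_mem_of_frequently (N := 0) le_rfl MeasurableSet.univ hG
    (c := 2⁻¹) (T := C) (by simp) (by simp) (fun k _ s hs => by
      rw [inter_univ]; exact hC (k * 1) s hs)
  have h2 := X.ae_mem_of_frequently (N := 0) le_rfl MeasurableSet.univ hG.compl
    (c := 2⁻¹) (T := Cᶜ) (by simp) (by simp) (fun k _ s hs => by
      rw [inter_univ]; exact hC' (k * 1) s hs)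
  filter_upwards [h1, h2] with ω hω1 hω2
  refine ⟨hω1 (mem_univ _), fun hωG => ?_⟩
  by_contra hL
  have hU : ω ∈ X.U 1 Cᶜ := by
    by_contra hU
    exact hL (by simpa using X.mem_L_compl_of_not_mem_U hU)
  exact hω2 (mem_univ _) hU hωG

/-- An irreducible chain on an infinite state space visits the complement of every finite set
infinitely often. -/
theorem ae_mem_U_compl_of_finite [Infinite S] (hirr : X.Irreducible) {F : Set S}
    (hF : F.Finite) : ∀ᵐ ω ∂X.μ, ω ∈ X.U 1 Fᶜ := by
  obtain ⟨j, hj⟩ := hF.exists_notMem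
  have hexit : ∀ N : ℕ, ∀ i : S, ∀ᵐ ω ∂X.μ, ω ∈ X.U 1 {i} → ∃ k, N ≤ k ∧ ω k ∉ F := by
    intro N i
    obtain ⟨l, hl⟩ := hirr i j
    have hG : MeasurableSet {ω : ℕ → S | ∃ k, N ≤ k ∧ ω k ∉ F} := by
      have : {ω : ℕ → S | ∃ k, N ≤ k ∧ ω k ∉ F} = ⋃ k, ⋃ _ : N ≤ k, {ω | ω k ∈ Fᶜ} := by
        ext ω; simp
      rw [this]
      exact .iUnion fun _ => .iUnion fun _ => measurableSet_coord _ _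
    have hc0 : X.ennPn l i j ≠ 0 := by
      intro h0
      rw [← X.toReal_ennPn, h0] at hl
      simp at hl
    have := X.ae_mem_of_frequently (N := N) le_rfl MeasurableSet.univ hG (T := {i})
      hc0 (X.ennPn_ne_top l i j) (fun k hk s hs => by
        rw [mul_one] at hs ⊢
        rw [inter_univ]
        have hM := X.μ_pathCylinder_inter k s l 0 (fun _ => j)
        rw [show s k = i from hs] at hM
        simp only [pathWeight, Finset.range_zero, Finset.prod_empty, mul_one] at hM
        rw [mul_comm, ← hM]
        refine measure_mono (inter_subset_inter_right _ fun ω hω => ⟨k + l, by omega, ?_⟩)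
        have h0 := hω 0 le_rfl
        simp only [pathDrop, zero_add] at h0
        rwa [h0])
    filter_upwards [this] with ω hω using hω (mem_univ _)
  have hall : ∀ᵐ ω ∂X.μ, ∀ N : ℕ, ∀ i : S, ω ∈ X.U 1 {i} → ∃ k, N ≤ k ∧ ω k ∉ F :=
    ae_all_iff.2 fun N => ae_all_iff.2 fun i => hexit N i
  filter_upwards [hall] with ω hω
  by_contra hU
  have hL : ω ∈ X.L 1 F := by simpa using X.mem_L_compl_of_not_mem_U hU
  obtain ⟨n, hn⟩ := hL
  have hev : ∀ᶠ k in atTop, ∀ i ∈ F, ω (k * 1) ≠ i := by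
    refine (Filter.eventually_all_finite hF).2 fun i _ => ?_
    have hi : ω ∉ X.U 1 {i} := fun hi => by
      obtain ⟨k, hk, hkF⟩ := hω n i hi
      exact hkF (by simpa using hn k hk)
    obtain ⟨a, ha⟩ := X.mem_L_compl_of_not_mem_U hi
    exact eventually_atTop.2 ⟨a, fun k hk => ha k hk⟩
  obtain ⟨k, hk, hkn⟩ := (hev.and (eventually_ge_atTop n)).exists
  exact hk _ (hn k hkn) rfl

/-- Under the return condition, an `m`-invariant event is almost surely stable under the shift
by `n`. -/
theorem ae_pathDrop_mem [Infinite S] (hirr : X.Irreducible) {n : ℕ} {δ : ℝ} (hδ : 0 < δ)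
    (hfin : {i : S | X.Pn n i i < δ}.Finite) {m : ℕ} (hm : 1 ≤ m) {E : Set (ℕ → S)}
    (hE : MeasurableSet E) (hinv : ∀ ω, pathDrop m ω ∈ E ↔ ω ∈ E) :
    ∀ᵐ ω ∂X.μ, ω ∈ E → pathDrop n ω ∈ E := by
  have h := X.ae_mem_of_frequently (N := 0) le_rfl hE (measurable_pathDrop n hE)
    (T := {i : S | X.Pn n i i < δ}ᶜ) (c := ENNReal.ofReal δ) (by simpa using hδ)
    ENNReal.ofReal_ne_top (fun k _ s hs => by
      rw [mul_one] at hs ⊢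
      have hs' : δ ≤ X.Pn n (s k) (s k) := not_lt.1 hs
      set B := pathDrop (k * m - k) ⁻¹' E with hB
      have hkm : k ≤ k * m := Nat.le_mul_of_pos_right k hm
      have hpre : ∀ ω, pathDrop k ω ∈ B ↔ ω ∈ E := by
        intro ω
        rw [hB, mem_preimage, pathDrop_pathDrop, Nat.sub_add_cancel hkm,
          pathDrop_mul_mem_iff hinv]
      have h1 : pathDrop k ⁻¹' B = E := by ext ω; exact hpre ω
      have h2 : pathDrop (k + n) ⁻¹' B = pathDrop n ⁻¹' E := by
        ext ω
        rw [mem_preimage, ← pathDrop_pathDrop, hpre, mem_preimage]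
      have hr := X.μ_pathCylinder_return k s n (measurable_pathDrop (k * m - k) hE)
      rw [← hB, h1, h2] at hr
      calc ENNReal.ofReal δ * X.μ (pathCylinder k s ∩ E)
          ≤ X.ennPn n (s k) (s k) * X.μ (pathCylinder k s ∩ E) := by
            gcongr; exact X.ofReal_le_ennPn hs'
        _ = _ := hr.symm
        _ ≤ _ := measure_mono (inter_subset_inter_left _ inter_subset_left))
  filter_upwards [h, X.ae_mem_U_compl_of_finite hirr hfin] with ω hω hU hωE using hω hωE hU

end ZeroOne

section Blackwell

variable {S : Type} [MeasurableSpace S] (X : MarkovChain S)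

theorem exists_isBlackwell_of_beta_eq {m k : ℕ} (h : X.beta m = (k : ℕ∞)) :
    ∃ 𝒞 : Set (Set S), X.IsBlackwell m 𝒞 ∧ 𝒞.encard = k := by
  have hne : (Set.encard '' {𝒞 : Set (Set S) | X.IsBlackwell m 𝒞}).Nonempty := by
    by_contra hne
    rw [Set.not_nonempty_iff_eq_empty] at hne
    rw [beta, hne, sInf_empty] at h
    exact ENat.natCast_ne_top k h.symm
  obtain ⟨𝒞, h𝒞, hc⟩ := csInf_mem hne
  exact ⟨𝒞, h𝒞, hc.trans h⟩

theorem U_subset_U_one {m : ℕ} (hm : 1 ≤ m) (C : Set S) : X.U m C ⊆ X.U 1 C := fun _ hω n => by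
  obtain ⟨k, hk, hkC⟩ := hω n
  exact ⟨k * m, hk.trans (Nat.le_mul_of_pos_right k hm), by rwa [mul_one]⟩

theorem L_one_subset_L {m : ℕ} (hm : 1 ≤ m) (C : Set S) : X.L 1 C ⊆ X.L m C := fun _ ⟨n, hn⟩ =>
  ⟨n, fun k hk => by simpa using hn (k * m) (hk.trans (Nat.le_mul_of_pos_right k hm))⟩

theorem pathDrop_mem_L_iff (m : ℕ) (C : Set S) (ω : ℕ → S) :
    pathDrop m ω ∈ X.L m C ↔ ω ∈ X.L m C := by
  constructor
  · rintro ⟨n, hn⟩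
    refine ⟨n + 1, fun k hk => ?_⟩
    obtain ⟨k, rfl⟩ : ∃ k', k = k' + 1 := ⟨k - 1, by omega⟩
    have := hn k (by omega)
    rwa [pathDrop, ← Nat.succ_mul] at this
  · rintro ⟨n, hn⟩
    refine ⟨n, fun k hk => ?_⟩
    rw [pathDrop, ← Nat.succ_mul]
    exact hn (k + 1) (by omega)

/-- A time `k < m` shift bringing the path into each member of a family of `m` disjoint sets is
unique, so a shift by `n` that preserves these events is a multiple of `m`. -/
theorem dvd_of_pathDrop_mem {m n : ℕ} (hm : 1 ≤ m) {𝒞 : Set (Set S)} (hcard : 𝒞.encard = m)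
    (hdisj : 𝒞.PairwiseDisjoint id) (ω : ℕ → S)
    (hex : ∀ C ∈ 𝒞, ∃ k < m, pathDrop k ω ∈ X.L m C)
    (hstable : ∀ C ∈ 𝒞, ∀ k, pathDrop k ω ∈ X.L m C → pathDrop (n + k) ω ∈ X.L m C) :
    m ∣ n := by
  have hLdisj : ∀ C ∈ 𝒞, ∀ D ∈ 𝒞, ∀ k, pathDrop k ω ∈ X.L m C → pathDrop k ω ∈ X.L m D →
      C = D := by
    intro C hC D hD k h1 h2
    by_contra hne
    exact X.not_mem_L_of_mem_U (hdisj hC hD hne) (X.L_subset_U m C h1) h2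
  have hfin : 𝒞.Finite := Set.finite_of_encard_eq_coe hcard
  have : Fintype 𝒞 := hfin.fintype
  have hcard' : Fintype.card 𝒞 = m := by
    rw [Set.encard_eq_coe_toFinset_card, Set.toFinset_card] at hcard
    exact_mod_cast hcard
  choose f hf hfL using fun C : 𝒞 => hex C C.2
  let F : 𝒞 → Fin m := fun C => ⟨f C, hf C⟩
  have hinj : Function.Injective F := by
    intro C D hCD
    have hfe : f C = f D := congrArg Fin.val hCD
    exact Subtype.ext (hLdisj C C.2 D D.2 (f C) (hfL C) (hfe ▸ hfL D))
  have hsurj : Function.Surjective F :=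
    ((Fintype.bijective_iff_injective_and_card F).2 ⟨hinj, by simp [hcard']⟩).2
  obtain ⟨C, hC⟩ := hsurj ⟨0, hm⟩
  have hC0 : f C = 0 := congrArg Fin.val hC
  obtain ⟨D, hD⟩ := hsurj ⟨n % m, Nat.mod_lt _ hm⟩
  have hDn : f D = n % m := congrArg Fin.val hD
  have h1 := hstable C C.2 (f C) (hfL C)
  rw [hC0, add_zero, ← Nat.div_add_mod' n m, ← pathDrop_pathDrop,
    pathDrop_mul_mem_iff (X.pathDrop_mem_L_iff m C)] at h1
  have hCD : C = D := Subtype.ext (hLdisj C C.2 D D.2 (n % m) h1 (hDn ▸ hfL D))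
  rw [← hCD, hC0] at hDn
  exact Nat.dvd_of_mod_eq_zero hDn.symm

theorem AlmostClosed.inter {m : ℕ} (hm : 1 ≤ m) {C A : Set S} (hC : X.AlmostClosed m C)
    (hA : X.AlmostClosed 1 A) (h : X.μ (X.L m C ∩ X.L 1 A) ≠ 0) :
    X.AlmostClosed m (C ∩ A) := by
  refine X.almostClosed_of_ae ?_ fun h0 => h (measure_mono_null (fun ω hω => ?_) h0)
  · filter_upwards [AlmostClosed.ae X hC, AlmostClosed.ae X hA] with ω h1 h2 hU
    exact X.L_inter (h1 (X.U_mono m inter_subset_left hU))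
      (X.L_one_subset_L hm A (h2 (X.U_subset_U_one hm A (X.U_mono m inter_subset_right hU))))
  · exact X.L_inter hω.1 (X.L_one_subset_L hm A hω.2)

variable [MeasurableSingletonClass S] [Countable S]

theorem Simple.exists_isBlackwell (h : X.Simple) :
    ∃ C₀ : Set S, X.IsBlackwell 1 {C₀} ∧ ∀ᵐ ω ∂X.μ, ω ∈ X.L 1 C₀ := by
  obtain ⟨𝒞, h𝒞, hc⟩ := X.exists_isBlackwell_of_beta_eq (k := 1) (by simpa [Simple] using h)
  obtain ⟨C₀, rfl⟩ := Set.encard_eq_one.1 (by simpa using hc)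
  refine ⟨C₀, h𝒞, ?_⟩
  have hsum := h𝒞.sum_L_eq_one
  rw [tsum_singleton C₀ fun C => X.μ (X.L 1 C)] at hsum
  exact mem_ae_iff_prob_eq_one (X.measurableSet_L 1 C₀) |>.2 hsum

/-- An invariant event is trivial if the whole chain ends up in an atomic set. -/
theorem ae_mem_of_atomic {C₀ : Set S} (hatom : X.Atomic 1 C₀) (hC₀ : ∀ᵐ ω ∂X.μ, ω ∈ X.L 1 C₀)
    {G : Set (ℕ → S)} (hG : MeasurableSet G) (hinv : ∀ ω, pathDrop 1 ω ∈ G ↔ ω ∈ G)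
    (h0 : X.μ G ≠ 0) : ∀ᵐ ω ∂X.μ, ω ∈ G := by
  by_contra hG'
  have hGc : X.μ Gᶜ ≠ 0 := hG'
  obtain ⟨C, hC⟩ := X.exists_set_of_invariant hG hinv
  refine hatom.2 ⟨C₀ ∩ C, C₀ ∩ Cᶜ, inter_subset_left, inter_subset_left,
    disjoint_compl_right.mono inter_subset_right inter_subset_right,
    X.almostClosed_of_ae ?_ ?_, X.almostClosed_of_ae ?_ ?_⟩
  · filter_upwards [hC₀, hC] with ω h₀ h hU
    exact X.L_inter h₀ (h.2 (h.1 (X.U_mono 1 inter_subset_right hU)))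
  · refine fun hL => h0 (measure_mono_null_ae ?_ hL)
    filter_upwards [hC₀, hC] with ω h₀ h hω using X.L_inter h₀ (h.2 hω)
  · filter_upwards [hC₀, hC] with ω h₀ h hU
    refine X.L_inter h₀ (X.mem_L_compl_of_not_mem_U fun hUC => ?_)
    exact X.not_mem_L_of_mem_U disjoint_compl_left (X.U_mono 1 inter_subset_right hU)
      (h.2 (h.1 hUC))
  · refine fun hL => hGc (measure_mono_null_ae ?_ hL)
    filter_upwards [hC₀, hC] with ω h₀ h hω
    exact X.L_inter h₀ (X.mem_L_compl_of_not_mem_U fun hUC => hω (h.1 hUC))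

/-- If the `m`-step chain has an atomic set, then so does the chain itself. -/
theorem exists_atomic_subset {C₀ : Set S} (hC₀ : ∀ᵐ ω ∂X.μ, ω ∈ X.L 1 C₀) {m : ℕ} (hm : 1 ≤ m)
    {C₁ : Set S} (hatom : X.Atomic m C₁) : ∃ A ⊆ C₀, X.Atomic 1 A := by
  let E := X.L m C₁
  have hE0 : X.μ E ≠ 0 := AlmostClosed.μ_L_ne_zero X hatom.1
  let 𝒢 : Set (Set (ℕ → S)) := {G | MeasurableSet G ∧ (∀ ω, pathDrop 1 ω ∈ G ↔ ω ∈ G) ∧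
    ∀ᵐ ω ∂X.μ, ω ∈ E → ω ∈ G}
  have huniv : univ ∈ 𝒢 := ⟨.univ, fun _ => Iff.rfl, by simp⟩
  obtain ⟨u, -, hlim, hu⟩ := exists_seq_tendsto_sInf (S := X.μ '' 𝒢) ⟨_, _, huniv, rfl⟩
    (OrderBot.bddBelow _)
  choose G' hG' hG'u using hu
  set G := ⋂ n, G' n with hGdef
  have hG : G ∈ 𝒢 := by
    refine ⟨.iInter fun n => (hG' n).1, fun ω => ?_, ?_⟩
    · simp only [hGdef, mem_iInter, (hG' _).2.1]
    · filter_upwards [ae_all_iff.2 fun n => (hG' n).2.2] with ω hω hE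
      exact mem_iInter.2 fun n => hω n hE
  have hmin : ∀ H ∈ 𝒢, X.μ G ≤ X.μ H := by
    intro H hH
    have h1 : X.μ G ≤ sInf (X.μ '' 𝒢) :=
      ge_of_tendsto' hlim fun n => (measure_mono (iInter_subset G' n)).trans (hG'u n).le
    exact h1.trans (csInf_le (OrderBot.bddBelow _) ⟨H, hH, rfl⟩)
  obtain ⟨C, hC⟩ := X.exists_set_of_invariant hG.1 hG.2.1
  have hUG : ∀ᵐ ω ∂X.μ, ω ∈ X.U 1 (C₀ ∩ C) → ω ∈ G := by
    filter_upwards [hC] with ω h hU using h.1 (X.U_mono 1 inter_subset_right hU)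
  have hGL : ∀ᵐ ω ∂X.μ, ω ∈ G → ω ∈ X.L 1 (C₀ ∩ C) := by
    filter_upwards [hC₀, hC] with ω h₀ h hω using X.L_inter h₀ (h.2 hω)
  refine ⟨C₀ ∩ C, inter_subset_left, X.almostClosed_of_ae ?_ ?_, ?_⟩
  · filter_upwards [hUG, hGL] with ω h1 h2 hU using h2 (h1 hU)
  · refine fun hL => hE0 (measure_mono_null_ae ?_ hL)
    filter_upwards [hG.2.2, hGL] with ω h1 h2 hω using h2 (h1 hω)
  · rintro ⟨A, B, hA, hB, hdisj, hAac, hBac⟩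
    have key : ∀ D ⊆ C₀ ∩ C, X.AlmostClosed 1 D → X.AlmostClosed m (C₁ ∩ D) := by
      intro D hD hDac
      refine AlmostClosed.inter X hm hatom.1 hDac fun h0 => ?_
      have hmem : G \ X.L 1 D ∈ 𝒢 := by
        refine ⟨hG.1.diff (X.measurableSet_L 1 D), fun ω => ?_, ?_⟩
        · rw [Set.mem_sdiff, Set.mem_sdiff, hG.2.1, X.pathDrop_mem_L_iff]
        · filter_upwards [hG.2.2, measure_eq_zero_iff_ae_notMem.1 h0] with ω h1 h2 hω
          exact ⟨h1 hω, fun hωD => h2 ⟨hω, hωD⟩⟩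
      have hpos : X.μ (G ∩ X.L 1 D) ≠ 0 := by
        refine fun h => AlmostClosed.μ_L_ne_zero X hDac (measure_mono_null_ae ?_ h)
        filter_upwards [hUG] with ω h1 hω
        exact ⟨h1 (X.U_mono 1 hD (X.L_subset_U 1 D hω)), hω⟩
      have hadd := measure_inter_add_sdiff (μ := X.μ) G (X.measurableSet_L 1 D)
      have hlt := ENNReal.lt_add_right (measure_ne_top X.μ (G \ X.L 1 D)) hpos
      rw [add_comm, hadd] at hlt
      exact absurd (hmin _ hmem) (not_le.2 hlt)
    exact hatom.2 ⟨C₁ ∩ A, C₁ ∩ B, inter_subset_left, inter_subset_left,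
      hdisj.mono inter_subset_right inter_subset_right, key A hA hAac, key B hB hBac⟩

theorem Simple.atomic_of_beta_eq {C₀ : Set S} (hB : X.IsBlackwell 1 {C₀})
    (hC₀ : ∀ᵐ ω ∂X.μ, ω ∈ X.L 1 C₀) {m : ℕ} (hm : 2 ≤ m) {𝒞 : Set (Set S)}
    (h𝒞 : X.IsBlackwell m 𝒞) (hcard : 𝒞.encard = m) : X.Atomic 1 C₀ := by
  by_contra hna
  have hnone : ∀ C ∈ 𝒞, ¬ X.Atomic m C := fun C _ hatom => by
    obtain ⟨A, hA, hAatom⟩ := X.exists_atomic_subset hC₀ (by omega) hatom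
    exact hB.nonatomicNoAtomicSubset C₀ rfl hna A hA hAatom
  have hle : 𝒞.encard ≤ 1 := Set.encard_le_one_iff.2 fun C D hC hD =>
    h𝒞.atMostOneNonatomic C hC D hD (hnone C hC) (hnone D hD)
  rw [hcard] at hle
  have : m ≤ 1 := by exact_mod_cast hle
  omega

theorem dvd_of_beta_eq [Infinite S] (hirr : X.Irreducible) (hsimple : X.Simple) {n : ℕ} {δ : ℝ}
    (hδ : 0 < δ) (hfin : {i : S | X.Pn n i i < δ}.Finite) {m : ℕ} (hm : 1 ≤ m)
    (hbeta : X.beta m = (m : ℕ∞)) : m ∣ n := by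
  rcases hm.eq_or_lt with rfl | hm2
  · exact one_dvd n
  obtain ⟨C₀, hB, hC₀⟩ := Simple.exists_isBlackwell X hsimple
  obtain ⟨𝒞, h𝒞, hcard⟩ := X.exists_isBlackwell_of_beta_eq hbeta
  have hatom := Simple.atomic_of_beta_eq X hB hC₀ hm2 h𝒞 hcard
  have hex : ∀ᵐ ω ∂X.μ, ∀ C ∈ 𝒞, ∃ k < m, pathDrop k ω ∈ X.L m C := by
    refine (ae_ball_iff h𝒞.countable).2 fun C hC => ?_
    refine X.ae_mem_of_atomic hatom hC₀ (G := {ω | ∃ k < m, pathDrop k ω ∈ X.L m C}) ?_ ?_ ?_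
    · have : {ω : ℕ → S | ∃ k < m, pathDrop k ω ∈ X.L m C}
          = ⋃ k, ⋃ _ : k < m, pathDrop k ⁻¹' X.L m C := by
        ext ω; simp
      rw [this]
      exact .iUnion fun k => .iUnion fun _ => measurable_pathDrop k (X.measurableSet_L m C)
    · intro ω
      simp only [mem_ofPred_eq, pathDrop_pathDrop]
      constructor
      · rintro ⟨k, hk, h⟩
        rcases (show k + 1 ≤ m from hk).eq_or_lt with hkm | hkm
        · rw [hkm, X.pathDrop_mem_L_iff] at h
          exact ⟨0, hm, h⟩
        · exact ⟨k + 1, hkm, h⟩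
      · rintro ⟨k, hk, h⟩
        rcases Nat.eq_zero_or_pos k with rfl | hk0
        · refine ⟨m - 1, by omega, ?_⟩
          rw [Nat.sub_add_cancel hm, X.pathDrop_mem_L_iff]
          exact h
        · exact ⟨k - 1, by omega, by rwa [Nat.sub_add_cancel hk0]⟩
    · refine fun h0 => AlmostClosed.μ_L_ne_zero X (h𝒞.almostClosed C hC)
        (measure_mono_null (fun ω hω => by exact ⟨0, hm, hω⟩) h0)
  have hstable : ∀ᵐ ω ∂X.μ, ∀ C ∈ 𝒞, ∀ k, pathDrop k ω ∈ X.L m C →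
      pathDrop (n + k) ω ∈ X.L m C := by
    refine (ae_ball_iff h𝒞.countable).2 fun C _ => ae_all_iff.2 fun k => ?_
    have := X.ae_pathDrop_mem hirr hδ hfin hm
      (measurable_pathDrop k (X.measurableSet_L m C)) (fun ω => by
        rw [mem_preimage, mem_preimage, pathDrop_pathDrop, add_comm, ← pathDrop_pathDrop,
          X.pathDrop_mem_L_iff])
    filter_upwards [this] with ω hω h
    have h' := hω h
    rwa [mem_preimage, pathDrop_pathDrop, add_comm] at h'
  obtain ⟨ω, h1, h2⟩ := (hex.and hstable).exists
  exact X.dvd_of_pathDrop_mem hm hcard h𝒞.disjoint ω h1 h2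

end Blackwell

end MarkovChain

variable {S : Type} [MeasurableSpace S] [MeasurableSingletonClass S]
  [Countable S] [Infinite S]

/-- If, for some `n ≥ 1`, there is a `δ > 0` with `P^n(i,i) ≥ δ`
for all but finitely many states `i`, then `d(X)` is a divisor of `n`. -/
theorem stmt12 (X : MarkovChain S) (hirr : X.Irreducible) (hap : X.Aperiodic)
    (hsimple : X.Simple) (n : ℕ) (hn : 1 ≤ n)
    (hδ : ∃ δ : ℝ, 0 < δ ∧ {i : S | X.Pn n i i < δ}.Finite) :
    X.period ∣ (n : ℕ∞) := by
  obtain ⟨δ, hδ, hfin⟩ := hδ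
  have hdvd := fun m hm hbeta => X.dvd_of_beta_eq hirr hsimple hδ hfin (m := m) hm hbeta
  have hmem := Set.Nonempty.csSup_mem
    (s := {d : ℕ∞ | ∃ m : ℕ, 1 ≤ m ∧ X.beta m = (m : ℕ∞) ∧ d = (m : ℕ∞)})
    ⟨1, 1, le_rfl, by simpa [MarkovChain.Simple] using hsimple, by simp⟩
    ((n.divisors.finite_toSet.image (fun m : ℕ => (m : ℕ∞))).subset (by
      rintro _ ⟨m, hm, hbeta, rfl⟩
      exact ⟨m, Nat.mem_divisors.2 ⟨hdvd m hm hbeta, by omega⟩, rfl⟩))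
  obtain ⟨m, hm, hbeta, hd⟩ := hmem
  rw [MarkovChain.period, hd]
  exact Nat.cast_dvd_cast (hdvd m hm hbeta)
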